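/- arXiv:1610.07829 — 3 statements merged into one kernel-verified Lean document; each statement's English description precedes it below -/
import Mathlib

section
/- There is a universal constant C > 0 with the following property. Let (Y,d) be a CAT(1) space and let P, Q, S ∈ Y satisfy d(P,Q) ≤ π/2, d(P,S) ≤ π/2 and 0 < d(Q,S) ≤ π/2. For η, η' ∈ [0,1] set P_{η'} = (1−η')P + η'Q and S_η = (1−η)S + ηQ. Then d²(P_{η'}, S_η) ≤ (sin²((1−η)·d(Q,S))/sin²(d(Q,S)))·(d(P,S)² − (d(Q,S) − d(Q,P))²) + ((1−η)(d(Q,S) − d(Q,P)) + (η' − η)·d(Q,S))² + C·(d(P,S) + |d(Q,S) − d(Q,P)| + |η − η'|)³. -/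
open scoped RealInnerProductSpace

noncomputable def sphereDist (x y : EuclideanSpace ℝ (Fin 3)) : ℝ :=
  Real.arccos ⟪x, y⟫

open Classical in
noncomputable def sphereInterp (x y : EuclideanSpace ℝ (Fin 3)) (t : ℝ) :
    EuclideanSpace ℝ (Fin 3) :=
  if Real.sin (sphereDist x y) = 0 then x
  else (Real.sin ((1 - t) * sphereDist x y) / Real.sin (sphereDist x y)) • x
     + (Real.sin (t * sphereDist x y) / Real.sin (sphereDist x y)) • y

/-- A CAT(1) structure on a complete metric space `Y`: every pair of points at
distance `< π` is joined by a constant-speed minimizing geodesic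
`t ↦ interp P Q t` (the point `(1-t)P + tQ`, at distance `t·d(P,Q)` from `P`),
and every geodesic triangle of perimeter `< 2π` satisfies the CAT(1)
comparison inequality with respect to any comparison triangle on the unit
sphere `S² ⊂ ℝ³` (with the angular metric). -/
structure CAT1Space (Y : Type*) [MetricSpace Y] [CompleteSpace Y] where
  interp : Y → Y → ℝ → Y
  interp_zero : ∀ P Q : Y, dist P Q < Real.pi → interp P Q 0 = P
  interp_one : ∀ P Q : Y, dist P Q < Real.pi → interp P Q 1 = Q
  interp_dist : ∀ P Q : Y, dist P Q < Real.pi →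
    ∀ s t : ℝ, s ∈ Set.Icc (0:ℝ) 1 → t ∈ Set.Icc (0:ℝ) 1 →
      dist (interp P Q s) (interp P Q t) = |s - t| * dist P Q
  comparison : ∀ P Q R : Y,
    dist P Q + dist Q R + dist R P < 2 * Real.pi →
    ∀ p q r : EuclideanSpace ℝ (Fin 3), ‖p‖ = 1 → ‖q‖ = 1 → ‖r‖ = 1 →
      sphereDist p q = dist P Q → sphereDist q r = dist Q R →
      sphereDist r p = dist R P →
      ∀ s t : ℝ, s ∈ Set.Icc (0:ℝ) 1 → t ∈ Set.Icc (0:ℝ) 1 →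
        dist (interp P Q t) (interp R Q s) ≤
          sphereDist (sphereInterp p q t) (sphereInterp r q s)

open Real in
lemma aux_cos_lower (y : ℝ) : y ^ 2 - y ^ 4 ≤ 2 - 2 * cos y := by
  by_cases h : |y| ≤ 1
  · have h1 := abs_le.1 (Real.cos_bound h)
    have h2 : |y| ^ 4 = y ^ 4 := by
      rw [show (4:ℕ) = 2 * 2 from rfl, pow_mul, pow_mul, sq_abs]
    rw [h2] at h1
    have : 0 ≤ y ^ 4 := by positivity
    nlinarith [h1.1, h1.2]
  · push Not at h
    have h3 : 1 ≤ y ^ 2 := by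
      rw [← sq_abs]; nlinarith
    nlinarith [Real.cos_le_one y]

open Real in
lemma aux_cos_upper (y : ℝ) : 2 - 2 * cos y ≤ y ^ 2 := by
  have := Real.one_sub_sq_div_two_le_cos (x := y)
  linarith

open Real in
lemma aux_ycos {y : ℝ} (h0 : 0 ≤ y) (h1 : y ≤ π / 2) :
    0 ≤ sin y - y * cos y ∧ sin y - y * cos y ≤ y ^ 3 / 2 := by
  constructor
  · rcases h1.lt_or_eq with h | h
    · have hc : 0 < cos y := cos_pos_of_mem_Ioo ⟨by linarith [pi_pos], h⟩
      have := Real.le_tan h0 h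
      rw [tan_eq_sin_div_cos, le_div_iff₀ hc] at this
      linarith
    · subst h; simp
  · have := Real.one_sub_sq_div_two_le_cos (x := y)
    have := Real.sin_le h0
    nlinarith

open Real in
lemma aux_deriv_bound {s a : ℝ} (hs0 : 0 ≤ s) (hs1 : s ≤ 1) (ha0 : 0 < a) (ha1 : a ≤ π / 2) :
    |(s * cos (s * a) * sin a - sin (s * a) * cos a) / sin a ^ 2| ≤ 6 := by
  have hpi := pi_lt_d2
  have hpi0 := pi_pos
  have hsa0 : 0 ≤ s * a := by positivity
  have hsa : s * a ≤ a := by nlinarith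
  have hsin : 2 / π * a ≤ sin a := Real.mul_le_sin ha0.le ha1
  have h2pi : (0.63:ℝ) ≤ 2 / π := by
    rw [le_div_iff₀ hpi0]; linarith
  have hsin' : 0.63 * a ≤ sin a := by nlinarith
  have hsinpos : 0 < sin a := by nlinarith
  have hsq : 0.39 * a ^ 2 ≤ sin a ^ 2 := by nlinarith
  obtain ⟨e1, e2⟩ := aux_ycos hsa0 (hsa.trans ha1)
  obtain ⟨e3, e4⟩ := aux_ycos ha0.le ha1
  have hsinle := Real.sin_le ha0.le
  have hcl := Real.one_sub_sq_div_two_le_cos (x := a)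
  have hc1 := Real.cos_le_one a
  have hc0 : 0 ≤ cos a := cos_nonneg_of_mem_Icc ⟨by linarith, ha1⟩
  have hcs1 := Real.cos_le_one (s * a)
  have hcs0 : 0 ≤ cos (s * a) := cos_nonneg_of_mem_Icc ⟨by linarith, by linarith⟩
  have hss := Real.sin_le hsa0
  have hss0 : 0 ≤ sin (s * a) := sin_nonneg_of_nonneg_of_le_pi hsa0 (by linarith)
  have hA : 0 ≤ s * cos (s * a) := by positivity
  have hA1 : s * cos (s * a) ≤ 1 := by nlinarith
  have hB1 : 0 ≤ s * cos (s * a) * (a - sin a) := mul_nonneg hA (by linarith)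
  have hB2 : s * cos (s * a) * (a - sin a) ≤ a ^ 3 / 2 := by
    have : a - sin a ≤ a ^ 3 / 2 := by nlinarith
    nlinarith
  have hC : (s * a) ^ 3 ≤ a ^ 3 := pow_le_pow_left₀ hsa0 hsa 3
  have hD1 : 0 ≤ sin (s * a) * (1 - cos a) := mul_nonneg hss0 (by linarith)
  have hD2 : sin (s * a) * (1 - cos a) ≤ a ^ 3 / 2 := by
    calc sin (s * a) * (1 - cos a) ≤ a * (a ^ 2 / 2) :=
          mul_le_mul (hss.trans hsa) (by linarith) (by linarith) ha0.le
      _ = a ^ 3 / 2 := by ring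
  have ha3 : a ^ 3 ≤ 1.6 * a ^ 2 := by nlinarith [sq_nonneg a]
  rw [abs_div, abs_of_pos (by positivity : 0 < sin a ^ 2), div_le_iff₀ (by positivity), abs_le]
  constructor <;> nlinarith

open Real in
lemma aux_lip_a {s a b : ℝ} (hs0 : 0 ≤ s) (hs1 : s ≤ 1) (ha0 : 0 < a) (ha1 : a ≤ π / 2)
    (hb0 : 0 < b) (hb1 : b ≤ π / 2) :
    |sin (s * a) / sin a - sin (s * b) / sin b| ≤ 6 * |a - b| := by
  have key := (convex_Ioc (0:ℝ) (π / 2)).norm_image_sub_le_of_norm_hasDerivWithin_le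
    (f := fun x => sin (s * x) / sin x)
    (f' := fun x => (s * cos (s * x) * sin x - sin (s * x) * cos x) / sin x ^ 2) (C := 6)
    (x := b) (y := a) ?_ ?_ ⟨hb0, hb1⟩ ⟨ha0, ha1⟩
  · simpa using key
  · intro x hx
    have hsx : sin x ≠ 0 := (sin_pos_of_pos_of_lt_pi hx.1 (by linarith [hx.2, pi_pos])).ne'
    have h1 : HasDerivAt (fun x => sin (s * x)) (s * cos (s * x)) x := by
      have := ((hasDerivAt_id x).const_mul s).sin
      simpa [mul_comm] using this
    exact (h1.div (hasDerivAt_sin x) hsx).hasDerivWithinAt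
  · intro x hx
    exact aux_deriv_bound hs0 hs1 hx.1 hx.2

open Real in
lemma aux_lip_s {s t a : ℝ} (ha0 : 0 < a) (ha1 : a ≤ π / 2) :
    |sin (s * a) / sin a - sin (t * a) / sin a| ≤ 2 * |s - t| := by
  have hpi0 := pi_pos
  have hsin : 2 / π * a ≤ sin a := Real.mul_le_sin ha0.le ha1
  have h2pi : (1/2:ℝ) ≤ 2 / π := by
    rw [le_div_iff₀ hpi0]; linarith [pi_lt_d2]
  have hsin' : 1/2 * a ≤ sin a := by nlinarith
  have hpos : 0 < sin a := by linarith
  have h := Real.abs_sin_sub_sin_le (s * a) (t * a)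
  rw [← sub_div, abs_div, abs_of_pos hpos, div_le_iff₀ hpos]
  rw [← sub_mul, abs_mul, abs_of_pos ha0] at h
  nlinarith [abs_nonneg (s - t)]

open Real in
lemma aux_ratio {s a : ℝ} (hs0 : 0 ≤ s) (hs1 : s ≤ 1) (ha0 : 0 < a) (ha1 : a ≤ π / 2) :
    0 ≤ sin (s * a) / sin a ∧ sin (s * a) / sin a ≤ 1 := by
  have hpos : 0 < sin a := sin_pos_of_pos_of_lt_pi ha0 (by linarith [pi_pos])
  have hsa : s * a ≤ a := by nlinarith
  constructor
  · exact div_nonneg (sin_nonneg_of_nonneg_of_le_pi (by positivity) (by linarith [pi_pos])) hpos.le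
  · rw [div_le_one hpos]
    exact sin_le_sin_of_le_of_le_pi_div_two (by nlinarith [pi_pos]) ha1 hsa

set_option maxHeartbeats 2000000 in
open Real in
lemma aux_main {a b c k x η η' : ℝ} (ha0 : 0 ≤ a) (ha1 : a ≤ π / 2) (hb0 : 0 < b)
    (hb1 : b ≤ π / 2) (hc1 : c ≤ π / 2) (hD : |b - a| ≤ c)
    (hk : cos c = cos a * cos b + sin a * sin b * k)
    (hη0 : 0 ≤ η) (hη1 : η ≤ 1) (hη0' : 0 ≤ η') (hη1' : η' ≤ 1)
    (hx0 : 0 ≤ x) (hx1 : x ≤ π)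
    (hx : cos x = cos ((1 - η') * a) * cos ((1 - η) * b)
      + sin ((1 - η') * a) * sin ((1 - η) * b) * k) :
    x ^ 2 ≤ sin ((1 - η) * b) ^ 2 / sin b ^ 2 * (c ^ 2 - (b - a) ^ 2)
      + ((1 - η) * (b - a) + (η' - η) * b) ^ 2
      + 200000 * (c + |b - a| + |η - η'|) ^ 3 := by
  have hpi := pi_lt_d2
  have hpi0 := pi_pos
  obtain ⟨D, hDdef⟩ : ∃ D, D = b - a := ⟨_, rfl⟩
  obtain ⟨h, hh⟩ : ∃ h, h = η - η' := ⟨_, rfl⟩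
  rw [← hDdef, ← hh]
  rw [← hDdef] at hD
  have hc0 : 0 ≤ c := (abs_nonneg D).trans hD
  obtain ⟨ε, hε⟩ : ∃ ε, ε = c + |D| + |h| := ⟨_, rfl⟩
  rw [← hε]
  have hDa := abs_nonneg D
  have hha := abs_nonneg h
  have hh1 : |h| ≤ 1 := by rw [hh, abs_le]; constructor <;> linarith
  have hε0 : 0 ≤ ε := by linarith
  have hε5 : ε ≤ 5 := by linarith
  have hDε : |D| ≤ ε := by linarith
  have hhε : |h| ≤ ε := by linarith
  have hcε : c ≤ ε := by linarith
  have hcD : 0 ≤ c ^ 2 - D ^ 2 := by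
    rw [← sq_abs D]
    have := pow_le_pow_left₀ hDa hD 2
    linarith
  have hcD' : c ^ 2 - D ^ 2 ≤ ε ^ 2 := by
    have := pow_le_pow_left₀ hc0 hcε 2
    linarith [sq_nonneg D]
  have hε3 : 0 ≤ ε ^ 3 := by positivity
  have hε32 : ε ^ 3 ≤ 5 * ε ^ 2 := by
    rw [pow_succ, mul_comm]
    exact mul_le_mul_of_nonneg_right hε5 (sq_nonneg ε)
  have hε43 : ε ^ 4 ≤ 5 * ε ^ 3 := by
    rw [pow_succ, mul_comm]
    exact mul_le_mul_of_nonneg_right hε5 hε3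
  have hD4 : D ^ 4 ≤ 5 * ε ^ 3 := by
    have : D ^ 4 ≤ ε ^ 4 := by
      rw [← (by decide : Even 4).pow_abs D]
      exact pow_le_pow_left₀ hDa hDε 4
    linarith
  obtain ⟨Rb, hRb⟩ : ∃ R, R = sin ((1 - η) * b) / sin b := ⟨_, rfl⟩
  obtain ⟨hRb0, hRb1⟩ := aux_ratio (s := 1 - η) (by linarith) (by linarith) hb0 hb1
  rw [← hRb] at hRb0 hRb1
  have hsb : 0 < sin b := sin_pos_of_pos_of_lt_pi hb0 (by linarith)
  rw [← div_pow, ← hRb]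
  obtain ⟨T, hT⟩ : ∃ T, T = 2 * (sin ((1 - η') * a) * sin ((1 - η) * b) * (1 - k)) := ⟨_, rfl⟩
  have hTb : T ≤ Rb ^ 2 * (c ^ 2 - D ^ 2) + 11 * ε ^ 3 := by
    rcases ha0.eq_or_lt with ha | ha
    · have : T = 0 := by rw [hT, ← ha]; simp
      rw [this]; positivity
    · obtain ⟨Ra, hRa⟩ : ∃ R, R = sin ((1 - η') * a) / sin a := ⟨_, rfl⟩
      obtain ⟨hRa0, hRa1⟩ := aux_ratio (s := 1 - η') (by linarith) (by linarith) ha ha1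
      rw [← hRa] at hRa0 hRa1
      have hsa : 0 < sin a := sin_pos_of_pos_of_lt_pi ha (by linarith)
      have l1 := aux_lip_a (s := 1 - η') (by linarith) (by linarith) ha ha1 hb0 hb1
      have l2 := aux_lip_s (s := 1 - η') (t := 1 - η) hb0 hb1
      rw [← hRa] at l1
      rw [← hRb] at l2
      have e1 : |a - b| = |D| := by rw [hDdef, abs_sub_comm]
      have e2 : |1 - η' - (1 - η)| = |h| := by rw [hh]; congr 1; ring
      rw [e1] at l1
      rw [e2] at l2
      have hRR : Ra - Rb ≤ 6 * ε := by
        have := (abs_le.1 l1).2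
        have := (abs_le.1 l2).2
        linarith
      have hTe : T = Ra * Rb * ((2 - 2 * cos c) - (2 - 2 * cos D)) := by
        have hcD : cos D = cos b * cos a + sin b * sin a := by rw [hDdef, cos_sub]
        have e3 : sin ((1 - η') * a) = Ra * sin a := by rw [hRa]; field_simp
        have e4 : sin ((1 - η) * b) = Rb * sin b := by rw [hRb]; field_simp
        rw [hT, e3, e4, hk, hcD]; ring
      have f1 := aux_cos_upper c
      have f2 := aux_cos_lower D
      have hab0 : 0 ≤ Ra * Rb := by positivity
      have hab1 : Ra * Rb ≤ 1 := mul_le_one₀ hRa1 hRb0 hRb1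
      have hab2 : Ra * Rb ≤ Rb ^ 2 + 6 * ε := by
        have w1 : (Ra - Rb) * Rb ≤ 6 * ε * Rb := mul_le_mul_of_nonneg_right hRR hRb0
        have w2 : 6 * ε * Rb ≤ 6 * ε := mul_le_of_le_one_right (by linarith) hRb1
        calc Ra * Rb = Rb ^ 2 + (Ra - Rb) * Rb := by ring
          _ ≤ _ := by linarith
      have g1 : T ≤ Ra * Rb * (c ^ 2 - D ^ 2) + Ra * Rb * D ^ 4 := by
        rw [hTe, ← mul_add]
        exact mul_le_mul_of_nonneg_left (by linarith) hab0
      have g2 : Ra * Rb * (c ^ 2 - D ^ 2) ≤ (Rb ^ 2 + 6 * ε) * (c ^ 2 - D ^ 2) :=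
        mul_le_mul_of_nonneg_right hab2 hcD
      have g3 : Ra * Rb * D ^ 4 ≤ D ^ 4 := by
        exact mul_le_of_le_one_left (by positivity) hab1
      have g4 : ε * (c ^ 2 - D ^ 2) ≤ ε * ε ^ 2 := mul_le_mul_of_nonneg_left hcD' hε0
      have g5 : (Rb ^ 2 + 6 * ε) * (c ^ 2 - D ^ 2)
          = Rb ^ 2 * (c ^ 2 - D ^ 2) + 6 * (ε * (c ^ 2 - D ^ 2)) := by ring
      have g6 : ε * ε ^ 2 = ε ^ 3 := by ring
      linarith
  obtain ⟨u, hu⟩ : ∃ u, u = (1 - η) * D + (η' - η) * b := ⟨_, rfl⟩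
  obtain ⟨v, hv⟩ : ∃ v, v = (1 - η) * b - (1 - η') * a := ⟨_, rfl⟩
  rw [← hu]
  have hb2 : b ≤ 2 := by linarith
  have hhb : |h * b| ≤ 2 * |h| := by
    rw [abs_mul, abs_of_pos hb0, mul_comm]
    exact mul_le_mul_of_nonneg_right hb2 hha
  have hub : |u| ≤ 2 * ε := by
    have : u = (1 - η) * D - h * b := by rw [hu, hh]; ring
    rw [this]
    have h1 := abs_sub ((1 - η) * D) (h * b)
    have h2 : |(1 - η) * D| ≤ |D| := by
      rw [abs_mul, abs_of_nonneg (by linarith : 0 ≤ 1 - η)]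
      exact mul_le_of_le_one_left hDa (by linarith)
    linarith
  have hvb : |v| ≤ 2 * ε := by
    have : v = (1 - η') * D - h * b := by rw [hv, hh, hDdef]; ring
    rw [this]
    have h1 := abs_sub ((1 - η') * D) (h * b)
    have h2 : |(1 - η') * D| ≤ |D| := by
      rw [abs_mul, abs_of_nonneg (by linarith : 0 ≤ 1 - η')]
      exact mul_le_of_le_one_left hDa (by linarith)
    linarith
  have hvu : v ^ 2 ≤ u ^ 2 + 4 * ε ^ 3 := by
    have h1 : v ^ 2 - u ^ 2 = (h * D) * (v + u) := by rw [hv, hu, hh, hDdef]; ring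
    have h2 : |h * D| ≤ ε * ε := by
      rw [abs_mul]; exact mul_le_mul hhε hDε hDa hε0
    have h3 : |v + u| ≤ 4 * ε := (abs_add_le v u).trans (by linarith)
    have h4 : (h * D) * (v + u) ≤ (ε * ε) * (4 * ε) := by
      refine (le_abs_self _).trans ?_
      rw [abs_mul]
      exact mul_le_mul h2 h3 (abs_nonneg _) (by positivity)
    have h5 : (ε * ε) * (4 * ε) = 4 * ε ^ 3 := by ring
    linarith
  have hv2 : v ^ 2 ≤ 4 * ε ^ 2 := by
    rw [← sq_abs]
    calc |v| ^ 2 ≤ (2 * ε) ^ 2 := pow_le_pow_left₀ (abs_nonneg v) hvb 2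
      _ = 4 * ε ^ 2 := by ring
  have hxe : 2 - 2 * cos x = (2 - 2 * cos v) + T := by
    rw [hx, hv, hT, cos_sub]; ring
  have hxv : 2 - 2 * cos x ≤ v ^ 2 + T := by
    rw [hxe]; linarith [aux_cos_upper v]
  have hT2 : T ≤ 56 * ε ^ 2 := by
    have : Rb ^ 2 ≤ 1 := pow_le_one₀ hRb0 hRb1
    have : Rb ^ 2 * (c ^ 2 - D ^ 2) ≤ 1 * (c ^ 2 - D ^ 2) := mul_le_mul_of_nonneg_right this hcD
    linarith
  have hxq : x ^ 2 ≤ 150 * ε ^ 2 := by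
    have h1 := Real.cos_le_one_sub_mul_cos_sq (x := x) (by rw [abs_of_nonneg hx0]; exact hx1)
    have h2 : (1/5 : ℝ) ≤ 2 / π ^ 2 := by
      rw [le_div_iff₀ (by positivity)]; nlinarith
    have h3 : 1/5 * x ^ 2 ≤ 2 / π ^ 2 * x ^ 2 := mul_le_mul_of_nonneg_right h2 (sq_nonneg x)
    linarith
  have hx4 : x ^ 4 ≤ 112500 * ε ^ 3 := by
    have : x ^ 4 ≤ (150 * ε ^ 2) ^ 2 := by
      rw [show x ^ 4 = (x ^ 2) ^ 2 by ring]
      exact pow_le_pow_left₀ (sq_nonneg x) hxq 2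
    have h5 : (150 * ε ^ 2) ^ 2 = 22500 * ε ^ 4 := by ring
    linarith
  have := aux_cos_lower x
  linarith

open Real in
lemma aux_exists_k {a b c : ℝ} (ha0 : 0 ≤ a) (ha1 : a ≤ π / 2) (hb0 : 0 < b)
    (hb1 : b ≤ π / 2) (hc0 : 0 ≤ c) (hc1 : c ≤ π / 2) (hD : |b - a| ≤ c) (hs : c ≤ a + b) :
    ∃ k : ℝ, -1 ≤ k ∧ k ≤ 1 ∧ cos c = cos a * cos b + sin a * sin b * k := by
  have hpi0 := pi_pos
  have hsb : 0 < sin b := sin_pos_of_pos_of_lt_pi hb0 (by linarith)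
  rcases ha0.eq_or_lt with ha | ha
  · refine ⟨1, by norm_num, le_rfl, ?_⟩
    subst ha
    have : c = b := by
      rw [sub_zero, abs_of_pos hb0] at hD; linarith
    simp [this]
  · have hsa : 0 < sin a := sin_pos_of_pos_of_lt_pi ha (by linarith)
    have hp : 0 < sin a * sin b := by positivity
    have h1 : cos (a + b) ≤ cos c := cos_le_cos_of_nonneg_of_le_pi hc0 (by linarith) hs
    have h2 : cos c ≤ cos (b - a) := by
      rw [← cos_abs (b - a)]
      exact cos_le_cos_of_nonneg_of_le_pi (abs_nonneg _) (by linarith) hD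
    rw [cos_add] at h1
    rw [cos_sub] at h2
    refine ⟨(cos c - cos a * cos b) / (sin a * sin b), ?_, ?_, ?_⟩
    · rw [le_div_iff₀ hp]; linarith
    · rw [div_le_iff₀ hp]; linarith
    · field_simp; ring

lemma aux_inner (e f q : EuclideanSpace ℝ (Fin 3)) (x y z w k : ℝ)
    (hq : ⟪q, q⟫ = 1) (heq : ⟪e, q⟫ = 0) (hfq : ⟪f, q⟫ = 0) (hef : ⟪e, f⟫ = k) :
    ⟪x • e + y • q, z • f + w • q⟫ = y * w + x * z * k := by
  have hqf : ⟪q, f⟫ = 0 := by rw [real_inner_comm]; exact hfq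
  simp only [inner_add_left, inner_add_right, real_inner_smul_left, real_inner_smul_right, hq, heq,
    hqf, hef]
  ring

open Real in
lemma aux_dist_q (e q : EuclideanSpace ℝ (Fin 3)) (hq : ⟪q, q⟫ = 1) (heq : ⟪e, q⟫ = 0)
    {a : ℝ} (ha0 : 0 ≤ a) (ha1 : a ≤ π) : sphereDist (sin a • e + cos a • q) q = a := by
  unfold sphereDist
  simp only [inner_add_left, real_inner_smul_left, hq, heq]
  simp [arccos_cos ha0 ha1]

open Real in
lemma aux_interp (e q : EuclideanSpace ℝ (Fin 3)) (hq : ⟪q, q⟫ = 1) (heq : ⟪e, q⟫ = 0)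
    {a : ℝ} (ha0 : 0 ≤ a) (ha1 : a ≤ π / 2) (t : ℝ) :
    sphereInterp (sin a • e + cos a • q) q t
      = sin ((1 - t) * a) • e + cos ((1 - t) * a) • q := by
  unfold sphereInterp
  rw [aux_dist_q e q hq heq ha0 (by linarith [pi_pos])]
  rcases ha0.eq_or_lt with ha | ha
  · subst ha; simp
  · have hsa : 0 < sin a := sin_pos_of_pos_of_lt_pi ha (by linarith [pi_pos])
    rw [if_neg hsa.ne', smul_add, smul_smul, smul_smul, add_assoc, ← add_smul]
    have e1 : sin ((1 - t) * a) / sin a * sin a = sin ((1 - t) * a) := by field_simp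
    have e2 : sin ((1 - t) * a) / sin a * cos a + sin (t * a) / sin a = cos ((1 - t) * a) := by
      rw [show t * a = a - (1 - t) * a by ring, sin_sub]
      field_simp; ring
    rw [e1, e2]

lemma aux_norm (v : EuclideanSpace ℝ (Fin 3)) (h : ⟪v, v⟫ = 1) : ‖v‖ = 1 := by
  rw [real_inner_self_eq_norm_sq] at h
  nlinarith [norm_nonneg v]

open Real in
lemma aux_trig_le (u v k : ℝ) (h0 : 0 ≤ sin u * sin v) (hk : -1 ≤ k) (hk1 : k ≤ 1) :
    -1 ≤ cos u * cos v + sin u * sin v * k ∧ cos u * cos v + sin u * sin v * k ≤ 1 := by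
  have h1 := cos_le_one (u - v)
  have h2 := neg_one_le_cos (u + v)
  rw [cos_sub] at h1
  rw [cos_add] at h2
  constructor <;> nlinarith

/-- Serbinowski's Estimate II in a CAT(1) space. -/
theorem statement0 :
    ∃ C : ℝ, 0 < C ∧
      ∀ (Y : Type) [MetricSpace Y] [CompleteSpace Y] (H : CAT1Space Y)
        (P Q S : Y),
        dist P Q ≤ Real.pi / 2 → dist P S ≤ Real.pi / 2 →
        0 < dist Q S → dist Q S ≤ Real.pi / 2 →
        ∀ η η' : ℝ, η ∈ Set.Icc (0:ℝ) 1 → η' ∈ Set.Icc (0:ℝ) 1 →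
          dist (H.interp P Q η') (H.interp S Q η) ^ 2 ≤
            Real.sin ((1 - η) * dist Q S) ^ 2 / Real.sin (dist Q S) ^ 2 *
              (dist P S ^ 2 - (dist Q S - dist Q P) ^ 2) +
            ((1 - η) * (dist Q S - dist Q P) + (η' - η) * dist Q S) ^ 2 +
            C * (dist P S + |dist Q S - dist Q P| + |η - η'|) ^ 3 := by
  refine ⟨200000, by norm_num, ?_⟩
  intro Y _ _ H P Q S hPQ hPS hQS0 hQS η η' hη hη'
  have hpi0 := Real.pi_pos
  rw [dist_comm Q P]
  have hcomp := H.comparison P Q S (by rw [dist_comm S P]; linarith)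
  have ha0 : 0 ≤ dist P Q := dist_nonneg
  have hc0 : 0 ≤ dist P S := dist_nonneg
  have hD : |dist Q S - dist P Q| ≤ dist P S := by
    rw [abs_le]
    have h1 := dist_triangle Q P S
    have h2 := dist_triangle P S Q
    rw [dist_comm Q P] at h1
    rw [dist_comm S Q] at h2
    constructor <;> linarith
  have hs : dist P S ≤ dist P Q + dist Q S := dist_triangle P Q S
  rw [dist_comm S P] at hcomp
  generalize dist P Q = a at *
  generalize dist Q S = b at *
  generalize dist P S = c at *
  obtain ⟨k, hk0, hk1, hk⟩ := aux_exists_k ha0 hPQ hQS0 hQS hc0 hPS hD hs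
  obtain ⟨e, f, q, hq, hee, hff, heq, hfq, hef⟩ : ∃ e f q : EuclideanSpace ℝ (Fin 3),
      ⟪q, q⟫ = 1 ∧ ⟪e, e⟫ = 1 ∧ ⟪f, f⟫ = 1 ∧ ⟪e, q⟫ = 0 ∧ ⟪f, q⟫ = 0 ∧ ⟪e, f⟫ = k := by
    refine ⟨!₂[1, 0, 0], !₂[k, Real.sqrt (1 - k ^ 2), 0], !₂[0, 0, 1], ?_, ?_, ?_, ?_, ?_, ?_⟩ <;>
      rw [PiLp.inner_apply, Fin.sum_univ_three] <;> simp
    · have := Real.mul_self_sqrt (by nlinarith : (0:ℝ) ≤ 1 - k ^ 2)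
      nlinarith
  have hsa' : 0 ≤ Real.sin ((1 - η') * a) :=
    Real.sin_nonneg_of_nonneg_of_le_pi (mul_nonneg (by linarith [hη'.2]) ha0)
      (by nlinarith [hη'.1])
  have hsb' : 0 ≤ Real.sin ((1 - η) * b) :=
    Real.sin_nonneg_of_nonneg_of_le_pi (mul_nonneg (by linarith [hη.2]) hQS0.le)
      (by nlinarith [hη.1])
  have key := hcomp (Real.sin a • e + Real.cos a • q) q (Real.sin b • f + Real.cos b • q)
    (aux_norm _ (by
      rw [aux_inner e e q _ _ _ _ 1 hq heq heq hee]
      nlinarith [Real.sin_sq_add_cos_sq a]))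
    (aux_norm _ hq)
    (aux_norm _ (by
      rw [aux_inner f f q _ _ _ _ 1 hq hfq hfq hff]
      nlinarith [Real.sin_sq_add_cos_sq b]))
    (aux_dist_q e q hq heq ha0 (by linarith))
    (by
      have := aux_dist_q f q hq hfq hQS0.le (by linarith)
      unfold sphereDist at this ⊢
      rw [real_inner_comm]; exact this)
    (by
      unfold sphereDist
      rw [real_inner_comm, aux_inner e f q _ _ _ _ k hq heq hfq hef, ← hk]
      exact Real.arccos_cos hc0 (by linarith))
    η η' hη hη'
  rw [aux_interp e q hq heq ha0 hPQ, aux_interp f q hq hfq hQS0.le hQS] at key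
  unfold sphereDist at key
  rw [aux_inner e f q _ _ _ _ k hq heq hfq hef] at key
  obtain ⟨b1, b2⟩ := aux_trig_le ((1 - η') * a) ((1 - η) * b) k (mul_nonneg hsa' hsb') hk0 hk1
  refine (pow_le_pow_left₀ dist_nonneg key 2).trans ?_
  exact aux_main ha0 hPQ hQS0 hQS hPS hD hk hη.1 hη.2 hη'.1 hη'.2 (Real.arccos_nonneg _)
    (Real.arccos_le_pi _) (Real.cos_arccos b1 b2)
end

section
/- Let (Ω,μ) be a measure space with 0 < μ(Ω) < ∞, let (Y,d) be a CAT(1) space, P ∈ Y, 0 < τ < π/4, and let f : Ω → Y be a measurable map with separable range such that f(x) lies in the closed ball of radius τ about P for μ-a.e. x. Then there exists a unique point Q* ∈ Y such that ∫_Ω d²(f(x), Q*) dμ = inf over Q ∈ Y of ∫_Ω d²(f(x), Q) dμ. -/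
open scoped RealInnerProductSpace

open MeasureTheory

lemma exists_triangle (L b a : ℝ) (hL0 : 0 < L) (hLp : L < Real.pi) 
    (ha0 : 0 ≤ a) (hper : a + b + L ≤ 2 * Real.pi)
    (h1 : a ≤ b + L) (h2 : b ≤ a + L) (h3 : L ≤ a + b) :
    ∃ p q r : EuclideanSpace ℝ (Fin 3), ‖p‖ = 1 ∧ ‖q‖ = 1 ∧ ‖r‖ = 1 ∧
      ⟪p, q⟫ = Real.cos L ∧ ⟪q, r⟫ = Real.cos b ∧ ⟪r, p⟫ = Real.cos a := by
  have hs : 0 < Real.sin L := Real.sin_pos_of_pos_of_lt_pi hL0 hLp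
  have c1 : Real.cos (b + L) ≤ Real.cos a := by
    rcases le_total (b + L) Real.pi with h | h
    · exact Real.cos_le_cos_of_nonneg_of_le_pi ha0 h h1
    · rw [← Real.cos_two_pi_sub (b + L)]
      exact Real.cos_le_cos_of_nonneg_of_le_pi ha0 (by linarith) (by linarith)
  have c2 : Real.cos a ≤ Real.cos (b - L) := by
    rw [← Real.cos_abs (b - L)]
    exact Real.cos_le_cos_of_nonneg_of_le_pi (abs_nonneg _) (by linarith)
      (abs_le.2 ⟨by linarith, by linarith⟩)
  rw [Real.cos_add] at c1
  rw [Real.cos_sub] at c2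
  obtain ⟨y, hy⟩ : ∃ y, y * Real.sin L = Real.cos a - Real.cos b * Real.cos L :=
    ⟨(Real.cos a - Real.cos b * Real.cos L) / Real.sin L, by field_simp⟩
  have hy1 : y ≤ Real.sin b := by
    refine le_of_mul_le_mul_right ?_ hs
    linarith
  have hy2 : -Real.sin b ≤ y := by
    refine le_of_mul_le_mul_right ?_ hs
    linarith
  have hy3 : 0 ≤ Real.sin b ^ 2 - y ^ 2 := by nlinarith
  have hz := Real.sq_sqrt hy3
  set z := Real.sqrt (Real.sin b ^ 2 - y ^ 2)
  have e1 := Real.sin_sq_add_cos_sq L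
  have e2 := Real.sin_sq_add_cos_sq b
  refine ⟨!₂[Real.cos L, Real.sin L, 0], !₂[1, 0, 0], !₂[Real.cos b, y, z], ?_, ?_, ?_, ?_, ?_, ?_⟩
  · rw [EuclideanSpace.norm_eq]; simp [Fin.sum_univ_three]
  · rw [EuclideanSpace.norm_eq]; simp [Fin.sum_univ_three]
  · rw [EuclideanSpace.norm_eq]; simp [Fin.sum_univ_three]; linarith
  · simp [PiLp.inner_apply, Fin.sum_univ_three]
  · simp [PiLp.inner_apply, Fin.sum_univ_three]
  · simp [PiLp.inner_apply, Fin.sum_univ_three]; linarith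

lemma comp_ineq {Y : Type*} [MetricSpace Y] [CompleteSpace Y] (H : CAT1Space Y)
    (P Q R : Y) (hPQ : 0 < dist P Q) 
    (hper : dist P Q + dist Q R + dist R P < 2 * Real.pi)
    (t : ℝ) (ht : t ∈ Set.Icc (0:ℝ) 1) :
    dist R (H.interp P Q t) ≤ Real.pi ∧
    Real.sin ((1 - t) * dist P Q) * Real.cos (dist R P) +
      Real.sin (t * dist P Q) * Real.cos (dist Q R) ≤
      Real.sin (dist P Q) * Real.cos (dist R (H.interp P Q t)) := by
  have hbn : 0 ≤ dist Q R := dist_nonneg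
  have t1 := dist_triangle R Q P
  have t2 := dist_triangle Q P R
  have t3 := dist_triangle P R Q
  have hLp : dist P Q < Real.pi := by
    rw [dist_comm P R, dist_comm R Q] at t3; linarith
  have hbp : dist R Q < Real.pi := by
    rw [dist_comm P R, dist_comm Q P] at t2
    rw [dist_comm]; linarith
  have haπ : dist R P ≤ Real.pi := by
    rw [dist_comm R Q, dist_comm Q P] at t1; linarith
  have hcomp := H.comparison P Q R hper
  obtain ⟨p, q, r, hp, hq, hr, e1, e2, e3⟩ := exists_triangle (dist P Q) (dist Q R) (dist R P)
    hPQ hLp dist_nonneg (by linarith) (by rw [dist_comm R Q, dist_comm Q P] at t1; exact t1)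
    (by rw [dist_comm Q P, dist_comm P R] at t2; linarith)
    (by rw [dist_comm P R, dist_comm R Q] at t3; exact t3)
  have s1 : sphereDist p q = dist P Q := by
    unfold sphereDist; rw [e1, Real.arccos_cos dist_nonneg hLp.le]
  have s2 : sphereDist q r = dist Q R := by
    unfold sphereDist; rw [e2, Real.arccos_cos dist_nonneg (by rw [dist_comm]; exact hbp.le)]
  have s3 : sphereDist r p = dist R P := by
    unfold sphereDist; rw [e3, Real.arccos_cos dist_nonneg haπ]
  have s4 : sphereDist r q = dist Q R := by
    rw [← s2]; unfold sphereDist; rw [real_inner_comm]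
  have h := hcomp p q r hp hq hr s1 s2 s3 0 t ⟨le_rfl, zero_le_one⟩ ht
  rw [H.interp_zero R Q hbp] at h
  have hrr : sphereInterp r q 0 = r := by
    unfold sphereInterp
    split_ifs with h0
    · rfl
    · simp [h0]
  have hs : 0 < Real.sin (dist P Q) := Real.sin_pos_of_pos_of_lt_pi hPQ hLp
  set L := dist P Q with hL
  have hpq : sphereInterp p q t = (Real.sin ((1 - t) * L) / Real.sin L) • p
     + (Real.sin (t * L) / Real.sin L) • q := by
    unfold sphereInterp
    rw [s1, if_neg hs.ne']
  rw [hrr] at h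
  set w := sphereInterp p q t
  have hnorm : ‖w‖ ^ 2 = 1 := by
    rw [hpq, norm_add_sq_real, norm_smul, norm_smul, inner_smul_left, inner_smul_right, e1, hp, hq]
    simp only [Real.norm_eq_abs, mul_one, sq_abs, conj_trivial]
    have key : Real.sin ((1 - t) * L) ^ 2 + 2 * (Real.sin ((1 - t) * L) * (Real.sin (t * L) * Real.cos L)) + Real.sin (t * L) ^ 2 = Real.sin L ^ 2 := by
      have hsum : L = (1 - t) * L + t * L := by ring
      generalize (1 - t) * L = x at *
      generalize t * L = y at *
      rw [hsum, Real.cos_add, Real.sin_add]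
      have i1 := Real.sin_sq_add_cos_sq x
      have i2 := Real.sin_sq_add_cos_sq y
      have j1 : Real.cos x ^ 2 = 1 - Real.sin x ^ 2 := by linarith
      have j2 : Real.cos y ^ 2 = 1 - Real.sin y ^ 2 := by linarith
      ring_nf
      rw [j1, j2]
      ring
    field_simp
    linarith
  have hw1 : ‖w‖ = 1 := by
    have := norm_nonneg w
    nlinarith
  have hin : ⟪w, r⟫ ≤ 1 := by
    have := real_inner_le_norm w r
    rw [hw1, hr] at this; linarith
  have hin' : -1 ≤ ⟪w, r⟫ := by
    have := (abs_le.1 (abs_real_inner_le_norm w r)).1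
    rw [hw1, hr] at this; linarith
  have hd : dist R (H.interp P Q t) ≤ Real.arccos ⟪w, r⟫ := by
    rw [dist_comm]; exact h
  have hπ := Real.arccos_le_pi ⟪w, r⟫
  refine ⟨hd.trans hπ, ?_⟩
  have hc : ⟪w, r⟫ ≤ Real.cos (dist R (H.interp P Q t)) := by
    have := Real.cos_le_cos_of_nonneg_of_le_pi dist_nonneg hπ hd
    rwa [Real.cos_arccos hin' hin] at this
  have hval : Real.sin L * ⟪w, r⟫ = Real.sin ((1 - t) * L) * Real.cos (dist R P) +
      Real.sin (t * L) * Real.cos (dist Q R) := by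
    rw [hpq, inner_add_left, inner_smul_left, inner_smul_left, e2, real_inner_comm, e3]
    simp only [conj_trivial]
    field_simp
  rw [← hval]
  exact mul_le_mul_of_nonneg_left hc hs.le

lemma mul_cos_le_sin {x : ℝ} (h0 : 0 ≤ x) (h1 : x ≤ Real.pi / 2) :
    x * Real.cos x ≤ Real.sin x := by
  rcases h1.lt_or_eq with h | h
  · have hc : 0 < Real.cos x := Real.cos_pos_of_mem_Ioo ⟨by linarith [Real.pi_pos], h⟩
    have := Real.le_tan h0 h
    rw [Real.tan_eq_sin_div_cos, le_div_iff₀ hc] at this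
    exact this
  · rw [h]; simp

lemma sin_ratio {m s : ℝ} (hm : 0 ≤ m) (hms : m ≤ s) (hs : s ≤ Real.pi) :
    m * Real.sin s ≤ s * Real.sin m := by
  rcases (hm.trans hms).eq_or_lt with h | h
  · have : m = 0 := by linarith
    simp [this, ← h]
  · have hc := strictConcaveOn_sin_Icc.concaveOn.2
      (show (0:ℝ) ∈ Set.Icc 0 Real.pi from ⟨le_rfl, Real.pi_pos.le⟩)
      (show s ∈ Set.Icc 0 Real.pi from ⟨h.le, hs⟩)
      (show 0 ≤ 1 - m / s by rw [sub_nonneg, div_le_one h]; exact hms)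
      (show 0 ≤ m / s by positivity) (by ring)
    simp only [smul_eq_mul, Real.sin_zero, mul_zero, zero_add] at hc
    rw [div_mul_cancel₀ _ h.ne', div_mul_eq_mul_div, div_le_iff₀ h] at hc
    linarith

lemma tangent_aux {a m : ℝ} (ha0 : 0 ≤ a) (ha : a ≤ Real.pi / 2)
    (hm0 : 0 ≤ m) (hm : m ≤ Real.pi / 2) :
    2 * m * (Real.cos m - Real.cos a) ≤ Real.sin m * (a ^ 2 - m ^ 2) := by
  have hπ := Real.pi_pos
  rw [Real.cos_sub_cos]
  rcases le_total m a with h | h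
  · obtain ⟨s, hs⟩ : ∃ s, s = (m + a) / 2 := ⟨_, rfl⟩
    obtain ⟨k, hk⟩ : ∃ k, k = (a - m) / 2 := ⟨_, rfl⟩
    have e1 : (m - a) / 2 = -k := by linarith
    rw [← hs, e1, Real.sin_neg]
    have e2 : a ^ 2 - m ^ 2 = 4 * s * k := by rw [hs, hk]; ring
    rw [e2]
    have r1 := sin_ratio hm0 (show m ≤ s by linarith) (by linarith)
    have r2 : Real.sin k ≤ k := Real.sin_le (by linarith)
    have r3 : 0 ≤ Real.sin s := Real.sin_nonneg_of_nonneg_of_le_pi (by linarith) (by linarith)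
    have r5 : 0 ≤ m * Real.sin s := by positivity
    have r6 : 0 ≤ k := by linarith
    nlinarith [mul_le_mul_of_nonneg_left r2 r5, mul_le_mul_of_nonneg_right r1 r6]
  · obtain ⟨s, hs⟩ : ∃ s, s = (m + a) / 2 := ⟨_, rfl⟩
    obtain ⟨k, hk⟩ : ∃ k, k = (m - a) / 2 := ⟨_, rfl⟩
    rw [← hs, ← hk]
    have e2 : a ^ 2 - m ^ 2 = -(4 * s * k) := by rw [hs, hk]; ring
    have e3 : m = s + k := by linarith
    rw [e2, e3, Real.sin_add]
    have s0 : 0 ≤ s := by linarith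
    have k0 : 0 ≤ k := by linarith
    have r1 := mul_cos_le_sin s0 (by linarith)
    have r2 := mul_cos_le_sin k0 (by linarith)
    have r3 : 0 ≤ Real.sin s := Real.sin_nonneg_of_nonneg_of_le_pi (by linarith) (by linarith)
    have r4 : 0 ≤ Real.sin k := Real.sin_nonneg_of_nonneg_of_le_pi (by linarith) (by linarith)
    nlinarith [mul_le_mul_of_nonneg_left r1 (mul_nonneg k0 r4),
      mul_le_mul_of_nonneg_left r2 (mul_nonneg s0 r3)]

lemma tangent {m : ℝ} (hm0 : 0 ≤ m) (hm : m ≤ Real.pi / 2) :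
    ∃ κ : ℝ, 1 ≤ κ ∧ ∀ a, 0 ≤ a → a ≤ Real.pi / 2 →
      2 * κ * (Real.cos m - Real.cos a) ≤ a ^ 2 - m ^ 2 := by
  rcases hm0.eq_or_lt with h | h
  · refine ⟨1, le_rfl, fun a _ _ => ?_⟩
    rw [← h, Real.cos_zero]
    linarith [Real.one_sub_sq_div_two_le_cos (x := a)]
  · have hs : 0 < Real.sin m := Real.sin_pos_of_pos_of_lt_pi h (by linarith [Real.pi_pos])
    refine ⟨m / Real.sin m, ?_, fun a h0 h1 => ?_⟩
    · rw [one_le_div hs]; exact Real.sin_le hm0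
    · have := tangent_aux h0 h1 hm0 hm
      rw [mul_div_assoc', div_mul_eq_mul_div, div_le_iff₀ hs]
      linarith

lemma midpoint_ineq {Y : Type*} [MetricSpace Y] [CompleteSpace Y] (H : CAT1Space Y)
    (τ : ℝ) (hτ0 : 0 < τ) (hτ : τ < Real.pi / 4) (P Q₀ Q₁ : Y)
    (h0 : dist Q₀ P ≤ τ) (h1 : dist Q₁ P ≤ τ) :
    ∃ M : Y, ∀ R, dist R P ≤ τ →
      dist R M ^ 2 ≤ (dist R Q₀ ^ 2 + dist R Q₁ ^ 2) / 2
        - Real.cos (2 * τ) / Real.pi ^ 2 * dist Q₀ Q₁ ^ 2 := by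
  have hπ := Real.pi_pos
  rcases (dist_nonneg (x := Q₀) (y := Q₁)).eq_or_lt with hL | hL
  · have : Q₀ = Q₁ := dist_eq_zero.1 hL.symm
    subst this
    exact ⟨Q₀, fun R _ => by simp⟩
  refine ⟨H.interp Q₀ Q₁ (1/2), fun R hR => ?_⟩
  have d1 := dist_triangle_right Q₀ Q₁ P
  have d2 := dist_triangle_right R Q₀ P
  have d3 := dist_triangle_right R Q₁ P
  have hb : dist Q₁ R ≤ 2 * τ := by rw [dist_comm]; linarith
  have ha : dist R Q₀ ≤ 2 * τ := by linarith
  obtain ⟨k1, k2⟩ := comp_ineq H Q₀ Q₁ R hL (by linarith) (1/2)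
    ⟨by norm_num, by norm_num⟩
  rw [dist_comm R Q₁]
  have hab : Real.cos (2 * τ) ≤ Real.cos (dist R Q₀) :=
    Real.cos_le_cos_of_nonneg_of_le_pi dist_nonneg (by linarith) ha
  have hbb : Real.cos (2 * τ) ≤ Real.cos (dist Q₁ R) :=
    Real.cos_le_cos_of_nonneg_of_le_pi dist_nonneg (by linarith) hb
  have hc0 : 0 < Real.cos (2 * τ) := Real.cos_pos_of_mem_Ioo ⟨by linarith, by linarith⟩
  have hm0 : 0 ≤ dist R (H.interp Q₀ Q₁ (1/2)) := dist_nonneg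
  have ha0 : 0 ≤ dist R Q₀ := dist_nonneg
  have hb0 : 0 ≤ dist Q₁ R := dist_nonneg
  have hLτ : dist Q₀ Q₁ ≤ 2 * τ := by linarith
  generalize dist R (H.interp Q₀ Q₁ (1/2)) = m at *
  generalize dist R Q₀ = a at *
  generalize dist Q₁ R = b at *
  generalize dist Q₀ Q₁ = L at *
  obtain ⟨l, hl⟩ : ∃ l, l = L / 2 := ⟨_, rfl⟩
  have hL2 : L = 2 * l := by linarith
  rw [show (1 - 1/2 : ℝ) * L = l by linarith, show (1/2 : ℝ) * L = l by linarith, hL2,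
    Real.sin_two_mul] at k2
  have hsl : 0 < Real.sin l := Real.sin_pos_of_pos_of_lt_pi (by linarith) (by linarith)
  have hcl : 0 < Real.cos l := Real.cos_pos_of_mem_Ioo ⟨by linarith, by linarith⟩
  have k3 : Real.cos a + Real.cos b ≤ 2 * Real.cos l * Real.cos m := by
    refine le_of_mul_le_mul_left ?_ hsl
    linarith
  have hcl1 : Real.cos l ≤ 1 := Real.cos_le_one l
  have k4 : 0 < Real.cos m := by
    by_contra! hneg
    nlinarith
  have k5 : Real.cos (2 * τ) ≤ Real.cos m := by nlinarith
  have hm : m ≤ Real.pi / 2 := by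
    by_contra! hlt
    have := Real.cos_nonpos_of_pi_div_two_le_of_le hlt.le (by linarith)
    linarith
  obtain ⟨κ, hκ, ht⟩ := tangent hm0 hm
  have ta := ht a ha0 (by linarith)
  have tb := ht b hb0 (by linarith)
  have hq : Real.cos l ≤ 1 - 2 / Real.pi ^ 2 * l ^ 2 :=
    Real.cos_le_one_sub_mul_cos_sq (abs_le.2 ⟨by linarith, by linarith⟩)
  have g1 : 2 * Real.cos m * (1 - Real.cos l) ≤ 2 * Real.cos m - (Real.cos a + Real.cos b) := by
    linarith
  have g2 : 0 ≤ 2 * Real.cos m * (1 - Real.cos l) := by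
    have : 0 ≤ 1 - Real.cos l := by linarith
    positivity
  have g3 : 2 * Real.cos m - (Real.cos a + Real.cos b) ≤ κ * (2 * Real.cos m - (Real.cos a + Real.cos b)) := by
    nlinarith
  have g4 : Real.cos (2 * τ) * (2 / Real.pi ^ 2 * l ^ 2) ≤ Real.cos m * (1 - Real.cos l) := by
    apply mul_le_mul k5 (by linarith) (by positivity) k4.le
  have e : Real.cos (2 * τ) / Real.pi ^ 2 * L ^ 2 = 2 * (Real.cos (2 * τ) * (2 / Real.pi ^ 2 * l ^ 2)) := by
    rw [hL2]; ring
  rw [e]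
  linarith

lemma proj {Y : Type*} [MetricSpace Y] [CompleteSpace Y] (H : CAT1Space Y)
    (τ : ℝ) (hτ0 : 0 < τ) (hτ : τ < Real.pi / 4) (P Q : Y) (hQ : τ < dist Q P) :
    ∃ Q' : Y, dist Q' P ≤ τ ∧ ∀ R, dist R P ≤ τ → dist R Q' < dist R Q := by
  have hπ := Real.pi_pos
  rcases lt_or_ge (2 * τ) (dist Q P) with h | h
  · refine ⟨P, by simp [hτ0.le], fun R hR => ?_⟩
    have := dist_triangle_left Q P R
    linarith
  have hD : dist P Q = dist Q P := dist_comm _ _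
  have hLπ : dist P Q < Real.pi := by linarith
  have hDpos : 0 < dist Q P := by linarith
  have htm : τ / dist Q P ∈ Set.Icc (0:ℝ) 1 := ⟨by positivity, by rw [div_le_one hDpos]; linarith⟩
  refine ⟨H.interp P Q (τ / dist Q P), ?_, fun R hR => ?_⟩
  · have := H.interp_dist P Q hLπ (τ / dist Q P) 0 htm ⟨le_rfl, zero_le_one⟩
    rw [H.interp_zero P Q hLπ, sub_zero, abs_of_nonneg htm.1, hD, div_mul_cancel₀ _ hDpos.ne'] at this
    exact this.le
  have d2 := dist_triangle_right R Q P
  have d4 := dist_triangle_left Q P R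
  rw [dist_comm R Q] at d2 d4 ⊢
  obtain ⟨k1, k2⟩ := comp_ineq H P Q R (by linarith) (by linarith)
    (τ / dist Q P) htm
  rw [hD, sub_mul, one_mul, div_mul_cancel₀ _ hDpos.ne'] at k2
  have hb0 : 0 ≤ dist Q R := dist_nonneg
  have hr0 : 0 ≤ dist R P := dist_nonneg
  by_contra! hcon
  have hcos : Real.cos (dist R (H.interp P Q (τ / dist Q P))) ≤ Real.cos (dist Q R) :=
    Real.cos_le_cos_of_nonneg_of_le_pi dist_nonneg k1 hcon
  have hbτ : dist Q R ≤ 3 * τ := by linarith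
  have hdr : dist Q P - τ ≤ dist Q R := by linarith
  generalize dist R (H.interp P Q (τ / dist Q P)) = m at *
  generalize dist Q R = d at *
  generalize dist R P = r at *
  generalize dist Q P = D at *
  have hsD : 0 < Real.sin D := Real.sin_pos_of_pos_of_lt_pi hDpos (by linarith)
  have k3 : Real.sin (D - τ) * Real.cos r + Real.sin τ * Real.cos d ≤ Real.sin D * Real.cos d :=
    k2.trans (mul_le_mul_of_nonneg_left hcos hsD.le)
  obtain ⟨h', hh⟩ : ∃ h', h' = (D - τ) / 2 := ⟨_, rfl⟩
  have e1 : Real.sin D - Real.sin τ = 2 * Real.sin h' * Real.cos (h' + τ) := by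
    rw [Real.sin_sub_sin, hh]; congr 2; ring
  have e2 : Real.sin (D - τ) = 2 * Real.sin h' * Real.cos h' := by
    rw [← Real.sin_two_mul, hh]; congr 1; ring
  have hsh : 0 < Real.sin h' := Real.sin_pos_of_pos_of_lt_pi (by linarith) (by linarith)
  have k4 : Real.cos h' * Real.cos r ≤ Real.cos (h' + τ) * Real.cos d := by
    refine le_of_mul_le_mul_left ?_ (show 0 < 2 * Real.sin h' by linarith)
    rw [e2] at k3
    have : 2 * Real.sin h' * (Real.cos (h' + τ) * Real.cos d) = (Real.sin D - Real.sin τ) * Real.cos d := by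
      rw [e1]; ring
    linarith
  have c1 : Real.cos τ ≤ Real.cos r := Real.cos_le_cos_of_nonneg_of_le_pi hr0 (by linarith) hR
  have c2 : Real.cos (h' + τ) < Real.cos τ :=
    Real.cos_lt_cos_of_nonneg_of_le_pi hτ0.le (by linarith) (by linarith)
  have c3 : 0 < Real.cos (h' + τ) := Real.cos_pos_of_mem_Ioo ⟨by linarith, by linarith⟩
  have c4 : Real.cos d ≤ Real.cos h' :=
    Real.cos_le_cos_of_nonneg_of_le_pi (by linarith) (by linarith) (by linarith)
  have c5 : 0 < Real.cos h' := Real.cos_pos_of_mem_Ioo ⟨by linarith, by linarith⟩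
  nlinarith [mul_le_mul_of_nonneg_left c4 c3.le, mul_lt_mul_of_pos_left (c2.trans_le c1) c5]


/-- Existence and uniqueness of the center of mass (minimizer of the
integrated squared distance) for an `L²` map into a small ball of a CAT(1)
space. -/
theorem statement9 (Ω : Type*) [MeasurableSpace Ω] (μ : Measure Ω)
    (hμ0 : 0 < μ Set.univ) (hμfin : μ Set.univ < ⊤)
    (Y : Type*) [MetricSpace Y] [CompleteSpace Y] (H : CAT1Space Y)
    (P : Y) (τ : ℝ) (hτ0 : 0 < τ) (hτ : τ < Real.pi / 4)
    (f : Ω → Y) (hf : StronglyMeasurable f)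
    (hball : ∀ᵐ x ∂μ, dist (f x) P ≤ τ) :
    ∃! Qstar : Y,
      ∫ x, dist (f x) Qstar ^ 2 ∂μ = ⨅ Q : Y, ∫ x, dist (f x) Q ^ 2 ∂μ := by
  have : IsFiniteMeasure μ := ⟨hμfin⟩
  have hμne : μ ≠ 0 := fun h => by simp [h] at hμ0
  have hμr : 0 < μ.real Set.univ := ENNReal.toReal_pos hμ0.ne' hμfin.ne
  set F : Y → ℝ := fun Q => ∫ x, dist (f x) Q ^ 2 ∂μ with hF
  have hmeas : ∀ Q, AEStronglyMeasurable (fun x => dist (f x) Q ^ 2) μ := fun Q =>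
    ((hf.dist stronglyMeasurable_const).pow 2).aestronglyMeasurable
  have hint : ∀ Q, Integrable (fun x => dist (f x) Q ^ 2) μ := by
    intro Q
    refine Integrable.of_bound (hmeas Q) ((τ + dist P Q) ^ 2) ?_
    filter_upwards [hball] with x hx
    have := dist_triangle (f x) P Q
    rw [Real.norm_of_nonneg (by positivity)]
    exact pow_le_pow_left₀ dist_nonneg (by linarith) 2
  have hF0 : ∀ Q, 0 ≤ F Q := fun Q => integral_nonneg fun x => by positivity
  have hbdd : BddBelow (Set.range F) := ⟨0, by rintro _ ⟨Q, rfl⟩; exact hF0 Q⟩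
  have hinf : ∀ Q, (⨅ Q, F Q) ≤ F Q := fun Q => ciInf_le hbdd Q
  have : Nonempty Y := ⟨P⟩
  have hproj : ∀ Q, τ < dist Q P → ∃ Q', dist Q' P ≤ τ ∧ F Q' < F Q := by
    intro Q hQ
    obtain ⟨Q', hQ', hlt⟩ := proj H τ hτ0 hτ P Q hQ
    refine ⟨Q', hQ', ?_⟩
    have hlt' : ∀ᵐ x ∂μ, dist (f x) Q' ^ 2 < dist (f x) Q ^ 2 := by
      filter_upwards [hball] with x hx
      exact pow_lt_pow_left₀ (hlt _ hx) dist_nonneg two_ne_zero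
    have hp : 0 < ∫ x, (dist (f x) Q ^ 2 - dist (f x) Q' ^ 2) ∂μ := by
      rw [integral_pos_iff_support_of_nonneg_ae
        (hlt'.mono fun x hx => sub_nonneg.2 hx.le) ((hint Q).sub (hint Q'))]
      have hsup : Function.support (fun x => dist (f x) Q ^ 2 - dist (f x) Q' ^ 2)
          =ᵐ[μ] Set.univ := by
        rw [Filter.eventuallyEq_univ]
        filter_upwards [hlt'] with x hx
        exact (sub_pos.2 hx).ne'
      rw [measure_congr hsup]
      exact hμ0
    rw [integral_sub (hint Q) (hint Q')] at hp
    exact sub_pos.1 hp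
  obtain ⟨k, hk, hmid⟩ : ∃ k > 0, ∀ Q₀ Q₁, dist Q₀ P ≤ τ → dist Q₁ P ≤ τ →
      k * dist Q₀ Q₁ ^ 2 ≤ (F Q₀ + F Q₁) / 2 - ⨅ Q, F Q := by
    have hc0 : 0 < Real.cos (2 * τ) := Real.cos_pos_of_mem_Ioo ⟨by linarith, by linarith⟩
    refine ⟨μ.real Set.univ * (Real.cos (2 * τ) / Real.pi ^ 2), by positivity, fun Q₀ Q₁ h0 h1 => ?_⟩
    obtain ⟨M, hM⟩ := midpoint_ineq H τ hτ0 hτ P Q₀ Q₁ h0 h1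
    have hi : Integrable (fun x => (dist (f x) Q₀ ^ 2 + dist (f x) Q₁ ^ 2) / 2) μ :=
      ((hint Q₀).add (hint Q₁)).div_const 2
    have hle : F M ≤ ∫ x, ((dist (f x) Q₀ ^ 2 + dist (f x) Q₁ ^ 2) / 2
        - Real.cos (2 * τ) / Real.pi ^ 2 * dist Q₀ Q₁ ^ 2) ∂μ := by
      refine integral_mono_ae (hint M) (hi.sub (integrable_const _)) ?_
      filter_upwards [hball] with x hx
      exact hM _ hx
    rw [integral_sub hi (integrable_const _),
      integral_div, integral_add (hint Q₀) (hint Q₁), integral_const, smul_eq_mul] at hle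
    have := hinf M
    have e : ∀ Q, ∫ x, dist (f x) Q ^ 2 ∂μ = F Q := fun Q => rfl
    rw [e, e] at hle
    linarith
  have hcont : ∀ Q₀ Q₁, dist Q₀ P ≤ τ → dist Q₁ P ≤ τ →
      F Q₀ ≤ F Q₁ + μ.real Set.univ * (4 * τ * dist Q₀ Q₁) := by
    intro Q₀ Q₁ h0 h1
    have hle : F Q₀ ≤ ∫ x, (dist (f x) Q₁ ^ 2 + 4 * τ * dist Q₀ Q₁) ∂μ := by
      refine integral_mono_ae (hint Q₀) ((hint Q₁).add (integrable_const _)) ?_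
      filter_upwards [hball] with x hx
      have d0 := dist_triangle_right (f x) Q₀ P
      have d1 := dist_triangle_right (f x) Q₁ P
      have d2 := dist_triangle_right (f x) Q₀ Q₁
      have n0 : 0 ≤ dist (f x) Q₀ := dist_nonneg
      have n1 : 0 ≤ dist (f x) Q₁ := dist_nonneg
      have n2 : 0 ≤ dist Q₀ Q₁ := dist_nonneg
      have w1 : dist (f x) Q₀ - dist (f x) Q₁ ≤ dist Q₀ Q₁ := by linarith
      have w2 : dist (f x) Q₀ + dist (f x) Q₁ ≤ 4 * τ := by linarith
      change dist (f x) Q₀ ^ 2 ≤ dist (f x) Q₁ ^ 2 + 4 * τ * dist Q₀ Q₁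
      nlinarith [mul_le_mul_of_nonneg_left w1 (add_nonneg n0 n1), mul_le_mul_of_nonneg_right w2 n2]
    rw [integral_add (hint Q₁) (integrable_const _), integral_const, smul_eq_mul] at hle
    exact hle
  change ∃! Qs, F Qs = ⨅ Q, F Q
  have hseq : ∀ n : ℕ, ∃ Q, dist Q P ≤ τ ∧ F Q < (⨅ Q, F Q) + 1 / ((n:ℝ) + 1) := by
    intro n
    obtain ⟨Q, hQ⟩ := exists_lt_of_ciInf_lt
      (show (⨅ Q, F Q) < (⨅ Q, F Q) + 1 / ((n:ℝ) + 1) from lt_add_of_pos_right _ (by positivity))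
    rcases le_or_gt (dist Q P) τ with h | h
    · exact ⟨Q, h, hQ⟩
    · obtain ⟨Q', h1, h2⟩ := hproj Q h
      exact ⟨Q', h1, h2.trans hQ⟩
  choose u hu1 hu2 using hseq
  have hlim0 : Filter.Tendsto (fun n : ℕ => 1 / ((n:ℝ) + 1)) Filter.atTop (nhds 0) :=
    tendsto_one_div_add_atTop_nhds_zero_nat
  have hcau : CauchySeq u := by
    refine cauchySeq_of_le_tendsto_0 (fun n : ℕ => Real.sqrt (1 / ((n:ℝ) + 1) / k)) ?_ ?_
    · intro n m N hn hm
      apply Real.le_sqrt_of_sq_le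
      rw [le_div_iff₀ hk]
      have h := hmid (u n) (u m) (hu1 n) (hu1 m)
      have a1 := hu2 n
      have a2 := hu2 m
      have b1 := Nat.one_div_le_one_div (α := ℝ) hn
      have b2 := Nat.one_div_le_one_div (α := ℝ) hm
      linarith
    · have := (hlim0.div_const k).sqrt
      simpa using this
  obtain ⟨Q, hQ⟩ := cauchySeq_tendsto_of_complete hcau
  have hQP : dist Q P ≤ τ := le_of_tendsto (hQ.dist tendsto_const_nhds)
    (Filter.Eventually.of_forall hu1)
  have hQmin : F Q = ⨅ Q, F Q := by
    refine le_antisymm ?_ (hinf Q)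
    have hd : Filter.Tendsto (fun n => dist Q (u n)) Filter.atTop (nhds 0) := by
      have := (tendsto_const_nhds (x := Q)).dist hQ
      simpa using this
    have hT : Filter.Tendsto (fun n : ℕ => ((⨅ Q, F Q) + 1 / ((n:ℝ) + 1)) +
        μ.real Set.univ * (4 * τ * dist Q (u n))) Filter.atTop
        (nhds (((⨅ Q, F Q) + 0) + μ.real Set.univ * (4 * τ * 0))) :=
      (tendsto_const_nhds.add hlim0).add ((hd.const_mul _).const_mul _)
    rw [mul_zero, mul_zero, add_zero, add_zero] at hT
    refine ge_of_tendsto' hT fun n => ?_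
    linarith [hcont Q (u n) hQP (hu1 n), hu2 n]
  refine ⟨Q, hQmin, fun Q' hQ' => ?_⟩
  have hQ' : F Q' = ⨅ Q, F Q := hQ'
  have hQ'P : dist Q' P ≤ τ := by
    by_contra! h
    obtain ⟨Q'', -, h2⟩ := hproj Q' h
    linarith [hinf Q'']
  have h := hmid Q' Q hQ'P hQP
  rw [hQ', hQmin] at h
  have h2 : dist Q' Q ^ 2 ≤ 0 := by
    by_contra! hpos
    nlinarith [mul_pos hk hpos]
  exact dist_eq_zero.1 (pow_eq_zero_iff two_ne_zero |>.1 (le_antisymm h2 (sq_nonneg _)))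
end

section
/- Let B(r) ⊂ ℝⁿ be the open Euclidean ball of radius r centered at the origin, (Y,d) a CAT(1) space, P ∈ Y, 0 < τ < π/4, and let f : B(r) → Y be a Lebesgue-measurable map with separable range such that d(f(x),P) < τ for a.e. x. Fix ϱ ∈ (0,1) and suppose there exist K > 0, R ∈ (0, (1−ϱ)r) and β ∈ (0,1] such that for every x ∈ B(ϱr) and every σ ∈ (0,R), inf over Q ∈ Y of σ^{−n}·∫_{B(x,σ)} d²(f(y), Q) dy ≤ K²·σ^{2β}. Then there exist C > 0, depending only on K, r, R, β, ϱ and n, and a representative in the a.e.-equivalence class of f, still denoted f, such that d(f(x), f(y)) ≤ C·|x−y|^β for all x, y ∈ B(ϱr). -/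
open scoped RealInnerProductSpace

open MeasureTheory

/-- Averaged triangle inequality. -/
theorem camp_tri {n : ℕ} {Y : Type} [MetricSpace Y]
    (f : EuclideanSpace ℝ (Fin n) → Y) (z : EuclideanSpace ℝ (Fin n)) (s : ℝ) (hs : 0 ≤ s)
    (hint : ∀ Q : Y, IntegrableOn (fun y => dist (f y) Q ^ 2) (Metric.closedBall z s))
    (a b : Y) (u v : ℝ)
    (hu : ∫ y in Metric.closedBall z s, dist (f y) a ^ 2 ≤ u)
    (hv : ∫ y in Metric.closedBall z s, dist (f y) b ^ 2 ≤ v) :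
    dist a b ^ 2 * (s ^ n *
      (volume : Measure (EuclideanSpace ℝ (Fin n))).real (Metric.ball 0 1)) ≤ 2 * (u + v) := by
  have hvol := Measure.addHaar_real_closedBall
    (volume : Measure (EuclideanSpace ℝ (Fin n))) z hs
  rw [finrank_euclideanSpace_fin] at hvol
  rw [← hvol]
  have hfin : (volume : Measure (EuclideanSpace ℝ (Fin n))) (Metric.closedBall z s) ≠ ⊤ :=
    measure_closedBall_lt_top.ne
  have h1 : ∫ _y in Metric.closedBall z s, dist a b ^ 2 ≤
      ∫ y in Metric.closedBall z s, (2 * dist (f y) a ^ 2 + 2 * dist (f y) b ^ 2) := by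
    apply integral_mono
    · exact integrableOn_const hfin
    · exact ((hint a).const_mul 2).add ((hint b).const_mul 2)
    · intro y
      have h := dist_triangle_left a b (f y)
      have h0 : 0 ≤ dist a b := dist_nonneg
      show dist a b ^ 2 ≤ 2 * dist (f y) a ^ 2 + 2 * dist (f y) b ^ 2
      nlinarith [sq_nonneg (dist (f y) a - dist (f y) b)]
  rw [integral_add ((hint a).const_mul 2) ((hint b).const_mul 2), integral_const_mul,
    integral_const_mul, setIntegral_const, smul_eq_mul] at h1
  linarith

theorem camp_sq {D w s c : ℝ} (hs : 0 < s) (hw : 0 < w) (h : D ^ 2 * (s * w) ≤ c * s) :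
    D ^ 2 ≤ c / w := by
  rw [le_div_iff₀ hw]
  have : D ^ 2 * w * s ≤ c * s := by linarith
  exact le_of_mul_le_mul_right this hs

/-- The limiting argument at Lebesgue points. -/
theorem camp_ae {n : ℕ} {Y : Type} [MetricSpace Y] (r : ℝ)
    (f : EuclideanSpace ℝ (Fin n) → Y)
    (hf : AEStronglyMeasurable f
          (volume.restrict (Metric.ball (0 : EuclideanSpace ℝ (Fin n)) r)))
    (hint : ∀ Q : Y, IntegrableOn (fun y => dist (f y) Q ^ 2)
      (Metric.ball (0 : EuclideanSpace ℝ (Fin n)) r))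
    (U : Set (EuclideanSpace ℝ (Fin n))) (hU : U ⊆ Metric.ball 0 r)
    (s e : ℕ → ℝ) (hs : ∀ k, 0 < s k) (hs0 : Filter.Tendsto s Filter.atTop (nhds 0))
    (he0 : Filter.Tendsto e Filter.atTop (nhds 0))
    (q : ℕ → EuclideanSpace ℝ (Fin n) → Y) (g : EuclideanSpace ℝ (Fin n) → Y)
    (hg : ∀ x ∈ U, Filter.Tendsto (fun k => q k x) Filter.atTop (nhds (g x)))
    (hsub : ∀ x ∈ U, ∀ k, Metric.closedBall x (s k) ⊆ Metric.ball 0 r)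
    (hq : ∀ x ∈ U, ∀ k, ∫ y in Metric.closedBall x (s k), dist (f y) (q k x) ^ 2
      ≤ e k * s k ^ n) :
    ∀ᵐ x ∂(volume.restrict (Metric.ball (0 : EuclideanSpace ℝ (Fin n)) r)),
      x ∈ U → g x = f x := by
  set w := (volume : Measure (EuclideanSpace ℝ (Fin n))).real (Metric.ball 0 1) with hw
  have hwpos : 0 < w := by
    rw [hw, measureReal_def]
    exact ENNReal.toReal_pos (Metric.measure_ball_pos _ _ one_pos).ne' measure_ball_lt_top.ne
  obtain ⟨D, hDc, hD⟩ := hf.stronglyMeasurable_mk.isSeparable_range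
  have hleb : ∀ᵐ x ∂(volume : Measure (EuclideanSpace ℝ (Fin n))), ∀ p ∈ D,
      Filter.Tendsto (fun k => ⨍ y in Metric.closedBall x (s k),
        (Metric.ball (0 : EuclideanSpace ℝ (Fin n)) r).indicator
          (fun y => dist (f y) p ^ 2) y) Filter.atTop
        (nhds ((Metric.ball (0 : EuclideanSpace ℝ (Fin n)) r).indicator
          (fun y => dist (f y) p ^ 2) x)) := by
    rw [ae_ball_iff hDc]
    intro p _
    have hli : LocallyIntegrable ((Metric.ball (0 : EuclideanSpace ℝ (Fin n)) r).indicator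
          (fun y => dist (f y) p ^ 2)) volume :=
      ((integrable_indicator_iff measurableSet_ball).2 (hint p)).locallyIntegrable
    filter_upwards [IsUnifLocDoublingMeasure.ae_tendsto_average (μ := volume) hli 1] with x hx
    refine hx (fun _ => x) s ?_ ?_
    · exact tendsto_nhdsWithin_iff.2 ⟨hs0, Filter.Eventually.of_forall hs⟩
    · refine Filter.Eventually.of_forall fun k => ?_
      simpa using (hs k).le
  filter_upwards [ae_restrict_of_ae hleb, hf.ae_eq_mk] with x hx hmk hxU
  have hfx : f x ∈ closure D := by
    rw [hmk]; exact hD ⟨x, rfl⟩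
  have key : ∀ p ∈ D, dist p (g x) ^ 2 ≤ 2 * dist (f x) p ^ 2 := by
    intro p hp
    have h1 := hx p hp
    rw [Set.indicator_of_mem (hU hxU)] at h1
    have h2 : Filter.Tendsto (fun k => dist p (q k x) ^ 2) Filter.atTop
        (nhds (dist p (g x) ^ 2)) := (tendsto_const_nhds.dist (hg x hxU)).pow 2
    have h3 := (h1.const_mul 2).add ((he0.div_const w).const_mul 2)
    have h4 : 2 * dist (f x) p ^ 2 + 2 * (0 / w) = 2 * dist (f x) p ^ 2 := by simp
    rw [h4] at h3
    refine le_of_tendsto_of_tendsto' h2 h3 fun k => ?_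
    have hpos : 0 < s k ^ n := pow_pos (hs k) n
    have hvol := Measure.addHaar_real_closedBall
      (volume : Measure (EuclideanSpace ℝ (Fin n))) x (hs k).le
    rw [finrank_euclideanSpace_fin, ← hw] at hvol
    have h5 := camp_tri f x (s k) (hs k).le
      (fun Q => (hint Q).mono_set (hsub x hxU k)) p (q k x) _ _ le_rfl (hq x hxU k)
    rw [← hw] at h5
    have h6 : ∫ y in Metric.closedBall x (s k),
        (Metric.ball (0 : EuclideanSpace ℝ (Fin n)) r).indicator
          (fun y => dist (f y) p ^ 2) y = ∫ y in Metric.closedBall x (s k), dist (f y) p ^ 2 :=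
      setIntegral_congr_fun measurableSet_closedBall fun y hy =>
        Set.indicator_of_mem (hsub x hxU k hy) _
    rw [setAverage_eq, hvol, h6, smul_eq_mul]
    set I := ∫ y in Metric.closedBall x (s k), dist (f y) p ^ 2
    have h7 : 2 * ((s k ^ n * w)⁻¹ * I) + 2 * (e k / w) =
        2 * (I + e k * s k ^ n) / (s k ^ n * w) := by
      field_simp
    rw [h7, le_div_iff₀ (by positivity)]
    exact h5
  have hclosed : IsClosed {p : Y | dist p (g x) ^ 2 ≤ 2 * dist (f x) p ^ 2} :=
    isClosed_le (by fun_prop) (by fun_prop)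
  have : dist (f x) (g x) ^ 2 ≤ 2 * dist (f x) (f x) ^ 2 :=
    closure_minimal (show D ⊆ {p : Y | dist p (g x) ^ 2 ≤ 2 * dist (f x) p ^ 2} from key)
      hclosed hfx
  rw [dist_self] at this
  have h0 : dist (f x) (g x) = 0 := by
    have h8 : (0:ℝ) ≤ dist (f x) (g x) := dist_nonneg
    nlinarith
  exact (dist_eq_zero.1 h0).symm

/-- Campanato-type lemma: an `L²` map from a Euclidean ball into a small ball
of a CAT(1) space whose scale-invariant local `L²` deviation from points
decays like `σ^{2β}` has a Hölder continuous representative, with constant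
depending only on `K, r, R, β, ϱ` and `n`. -/
theorem statement12 (n : ℕ) (K r R β ϱ : ℝ)
    (hK : 0 < K) (hr : 0 < r) (hϱ : ϱ ∈ Set.Ioo (0:ℝ) 1)
    (hR : R ∈ Set.Ioo 0 ((1 - ϱ) * r)) (hβ : β ∈ Set.Ioc (0:ℝ) 1) :
    ∃ C : ℝ, 0 < C ∧
      ∀ (Y : Type) [MetricSpace Y] [CompleteSpace Y] (H : CAT1Space Y)
        (P : Y) (τ : ℝ), 0 < τ → τ < Real.pi / 4 →
        ∀ f : EuclideanSpace ℝ (Fin n) → Y,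
        AEStronglyMeasurable f
          (volume.restrict (Metric.ball (0 : EuclideanSpace ℝ (Fin n)) r)) →
        (∀ᵐ x ∂(volume.restrict (Metric.ball (0 : EuclideanSpace ℝ (Fin n)) r)),
          dist (f x) P < τ) →
        (∀ x ∈ Metric.ball (0 : EuclideanSpace ℝ (Fin n)) (ϱ * r),
          ∀ σ ∈ Set.Ioo (0:ℝ) R,
            (⨅ Q : Y, (σ ^ n)⁻¹ * ∫ y in Metric.ball x σ, dist (f y) Q ^ 2) ≤
              K ^ 2 * σ ^ (2 * β)) →
        ∃ g : EuclideanSpace ℝ (Fin n) → Y,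
          (∀ᵐ x ∂(volume.restrict (Metric.ball (0 : EuclideanSpace ℝ (Fin n)) r)),
            g x = f x) ∧
          ∀ x ∈ Metric.ball (0 : EuclideanSpace ℝ (Fin n)) (ϱ * r),
            ∀ y ∈ Metric.ball (0 : EuclideanSpace ℝ (Fin n)) (ϱ * r),
              dist (g x) (g y) ≤ C * dist x y ^ β := by
  obtain ⟨hϱ0, hϱ1⟩ := hϱ
  obtain ⟨hR0, hR1⟩ := hR
  obtain ⟨hβ0, hβ1⟩ := hβ
  set w := (volume : Measure (EuclideanSpace ℝ (Fin n))).real (Metric.ball 0 1) with hw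
  have hwpos : 0 < w := by
    rw [hw, measureReal_def]
    exact ENNReal.toReal_pos (Metric.measure_ball_pos _ _ one_pos).ne' measure_ball_lt_top.ne
  obtain ⟨σ, hσ⟩ : ∃ σ : ℕ → ℝ, ∀ k, σ k = R / 2 * (1 / 2) ^ k := ⟨_, fun _ => rfl⟩
  obtain ⟨a, ha⟩ : ∃ a : ℕ → ℝ, ∀ k, a k = σ k ^ β := ⟨_, fun _ => rfl⟩
  obtain ⟨ρ, hρ⟩ : ∃ ρ : ℝ, ρ = (1 / 2 : ℝ) ^ β := ⟨_, rfl⟩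
  have hρ0 : 0 < ρ := by rw [hρ]; positivity
  have hρ1 : ρ < 1 := by rw [hρ]; exact Real.rpow_lt_one (by norm_num) (by norm_num) hβ0
  have hσpos : ∀ k, 0 < σ k := fun k => by rw [hσ]; positivity
  have hσsucc : ∀ k, σ (k + 1) = σ k / 2 := fun k => by rw [hσ, hσ, pow_succ]; ring
  have hσR : ∀ k, σ k < R := fun k => by
    rw [hσ]
    have : (1 / 2 : ℝ) ^ k ≤ 1 := pow_le_one₀ (by norm_num) (by norm_num)
    nlinarith
  have hapos : ∀ k, 0 < a k := fun k => by rw [ha]; exact Real.rpow_pos_of_pos (hσpos k) _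
  have hak : ∀ k, a k = a 0 * ρ ^ k := fun k => by
    rw [ha, ha, hσ, hσ, hρ, pow_zero, mul_one, Real.mul_rpow (by positivity) (by positivity),
      ← Real.rpow_natCast, ← Real.rpow_mul (by norm_num), ← Real.rpow_natCast,
      ← Real.rpow_mul (by norm_num), mul_comm β]
  have hasucc : ∀ k, a (k + 1) ≤ a k := fun k => by
    rw [ha, ha, hσsucc]
    exact Real.rpow_le_rpow (by linarith [hσpos k]) (by linarith [hσpos k]) hβ0.le
  have hasq : ∀ k, σ k ^ (2 * β) = a k ^ 2 := fun k => by
    rw [ha, ← Real.rpow_natCast, ← Real.rpow_mul (hσpos k).le]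
    norm_num [mul_comm]
  obtain ⟨M, hM0, hM⟩ : ∃ M : ℝ, 0 ≤ M ∧ M ^ 2 = 8 * K ^ 2 * 4 ^ n / w :=
    ⟨_, Real.sqrt_nonneg _, Real.sq_sqrt (by positivity)⟩
  obtain ⟨L, hL0, hL⟩ : ∃ L : ℝ, 0 ≤ L ∧
      L ^ 2 = 2 * (2 * K ^ 2 * a 0 ^ 2 * 2 ^ n + w) / w :=
    ⟨_, Real.sqrt_nonneg _, Real.sq_sqrt (by positivity)⟩
  obtain ⟨T, hT⟩ : ∃ T : ℝ, T = 1 / (1 - ρ) := ⟨_, rfl⟩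
  have hT0 : 0 < T := by rw [hT]; exact one_div_pos.2 (by linarith)
  have ha0 := hapos 0
  have ha1 := hapos 1
  refine ⟨4 * M * (2 * T + 1) + 2 * (M * a 0 * T + L) / a 1 + 1, by positivity, ?_⟩
  intro Y _ _ _ P τ hτ0 hτ1 f hf hfP hinf
  have hτ2 : τ < 1 := by linarith [Real.pi_le_four]
  have hint : ∀ Q : Y, IntegrableOn (fun y => dist (f y) Q ^ 2)
      (Metric.ball (0 : EuclideanSpace ℝ (Fin n)) r) := by
    intro Q
    haveI : IsFiniteMeasure (volume.restrict
        (Metric.ball (0 : EuclideanSpace ℝ (Fin n)) r)) :=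
      ⟨by rw [Measure.restrict_apply_univ]; exact measure_ball_lt_top⟩
    refine Integrable.of_bound (C := (1 + dist P Q) ^ 2) ?_ ?_
    · exact ((continuous_id.dist continuous_const).pow 2).comp_aestronglyMeasurable hf
    · filter_upwards [hfP] with x hx
      rw [Real.norm_of_nonneg (by positivity)]
      have := dist_triangle (f x) P Q
      exact pow_le_pow_left₀ dist_nonneg (by linarith) 2
  have hsubb : ∀ x ∈ Metric.ball (0 : EuclideanSpace ℝ (Fin n)) (ϱ * r), ∀ s : ℝ, s ≤ R →
      Metric.ball x s ⊆ Metric.ball 0 r := by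
    intro x hx s hs
    apply Metric.ball_subset_ball'
    rw [Metric.mem_ball] at hx
    nlinarith
  have hex : ∀ k : ℕ, ∀ x : EuclideanSpace ℝ (Fin n), ∃ Q : Y, x ∈ Metric.ball 0 (ϱ * r) →
      ∫ y in Metric.ball x (σ k), dist (f y) Q ^ 2 ≤ 2 * K ^ 2 * a k ^ 2 * σ k ^ n := by
    intro k x
    by_cases hx : x ∈ Metric.ball (0 : EuclideanSpace ℝ (Fin n)) (ϱ * r)
    · have h1 := hinf x hx (σ k) ⟨hσpos k, hσR k⟩
      rw [hasq] at h1
      have hap := hapos k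
      have h2 : K ^ 2 * a k ^ 2 < 2 * K ^ 2 * a k ^ 2 := by
        have : 0 < K ^ 2 * a k ^ 2 := by positivity
        linarith
      haveI : Nonempty Y := ⟨P⟩
      obtain ⟨Q, hQ⟩ := exists_lt_of_ciInf_lt (lt_of_le_of_lt h1 h2)
      refine ⟨Q, fun _ => ?_⟩
      have hp : 0 < σ k ^ n := pow_pos (hσpos k) n
      rw [inv_mul_lt_iff₀ hp] at hQ
      linarith
    · exact ⟨P, fun h => absurd h hx⟩
  choose q hq using hex
  -- restriction of the bound to smaller sets
  have hqS : ∀ k, ∀ x ∈ Metric.ball (0 : EuclideanSpace ℝ (Fin n)) (ϱ * r),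
      ∀ S ⊆ Metric.ball x (σ k),
      ∫ y in S, dist (f y) (q k x) ^ 2 ≤ 2 * K ^ 2 * a k ^ 2 * σ k ^ n := by
    intro k x hx S hS
    refine le_trans (setIntegral_mono_set ((hint _).mono_set (hsubb x hx _ (hσR k).le)) ?_
      hS.eventuallyLE) (hq k x hx)
    exact Filter.Eventually.of_forall fun y => sq_nonneg _
  have hsubc : ∀ k, ∀ x : EuclideanSpace ℝ (Fin n),
      Metric.closedBall x (σ (k + 1)) ⊆ Metric.ball x (σ k) := by
    intro k x
    apply Metric.closedBall_subset_ball
    linarith [hσsucc k, hσpos k]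
  -- main step
  have hstep : ∀ k, ∀ x ∈ Metric.ball (0 : EuclideanSpace ℝ (Fin n)) (ϱ * r),
      ∀ z ∈ Metric.ball (0 : EuclideanSpace ℝ (Fin n)) (ϱ * r), dist x z ≤ σ (k + 1) →
      dist (q k x) (q (k + 1) z) ≤ M * a k := by
    intro k x hx z hz hxz
    have hs1 : Metric.closedBall z (σ (k + 2)) ⊆ Metric.ball x (σ k) := by
      apply Metric.closedBall_subset_ball'
      rw [dist_comm z x]
      linarith [hσsucc k, hσsucc (k + 1), hσpos k]
    have h1 := camp_tri f z (σ (k + 2)) (hσpos _).le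
      (fun Q => (hint Q).mono_set (hs1.trans (hsubb x hx _ (hσR k).le))) _ _ _ _
      (hqS k x hx _ hs1) (hqS (k + 1) z hz _ (hsubc (k + 1) z))
    rw [← hw] at h1
    have hpk : σ k = 4 * σ (k + 2) := by linarith [hσsucc k, hσsucc (k + 1)]
    have hle : σ (k + 1) ^ n ≤ σ k ^ n :=
      pow_le_pow_left₀ (hσpos _).le (by linarith [hσsucc k, hσpos k]) n
    have hle2 : a (k + 1) ^ 2 ≤ a k ^ 2 := pow_le_pow_left₀ (hapos _).le (hasucc k) 2
    have h2 : a (k + 1) ^ 2 * σ (k + 1) ^ n ≤ a k ^ 2 * σ k ^ n :=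
      mul_le_mul hle2 hle (pow_nonneg (hσpos _).le n) (sq_nonneg _)
    have h3 := mul_le_mul_of_nonneg_left h2 (sq_nonneg K)
    have h4 : dist (q k x) (q (k + 1) z) ^ 2 * (σ (k + 2) ^ n * w) ≤
        (8 * K ^ 2 * 4 ^ n * a k ^ 2) * σ (k + 2) ^ n := by
      have : σ k ^ n = 4 ^ n * σ (k + 2) ^ n := by rw [hpk, mul_pow]
      calc _ ≤ _ := h1
        _ ≤ 8 * (K ^ 2 * (a k ^ 2 * σ k ^ n)) := by linarith
        _ = _ := by rw [this]; ring
    have h5 := camp_sq (pow_pos (hσpos (k + 2)) n) hwpos h4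
    have h6 : 8 * K ^ 2 * 4 ^ n * a k ^ 2 / w = (M * a k) ^ 2 := by
      rw [mul_pow, hM]; ring
    rw [h6] at h5
    exact le_of_abs_le (abs_le_of_sq_le_sq h5 (mul_nonneg hM0 (hapos k).le))
  have hgeo : ∀ x ∈ Metric.ball (0 : EuclideanSpace ℝ (Fin n)) (ϱ * r), ∀ k,
      dist (q k x) (q (k + 1) x) ≤ M * a 0 * ρ ^ k := by
    intro x hx k
    have := hstep k x hx x hx (by rw [dist_self]; exact (hσpos _).le)
    rw [hak k] at this
    linarith
  have hlim : ∀ x : EuclideanSpace ℝ (Fin n), ∃ G : Y, x ∈ Metric.ball 0 (ϱ * r) →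
      Filter.Tendsto (fun k => q k x) Filter.atTop (nhds G) := by
    intro x
    by_cases hx : x ∈ Metric.ball (0 : EuclideanSpace ℝ (Fin n)) (ϱ * r)
    · obtain ⟨G, hG⟩ := cauchySeq_tendsto_of_complete
        (cauchySeq_of_le_geometric ρ (M * a 0) hρ1 (hgeo x hx))
      exact ⟨G, fun _ => hG⟩
    · exact ⟨P, fun h => absurd h hx⟩
  choose G hG using hlim
  have hGq : ∀ x ∈ Metric.ball (0 : EuclideanSpace ℝ (Fin n)) (ϱ * r), ∀ k,
      dist (q k x) (G x) ≤ M * a k * T := by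
    intro x hx k
    have := dist_le_of_le_geometric_of_tendsto ρ (M * a 0) hρ1 (hgeo x hx) (hG x hx) k
    rw [hak k, hT]
    calc _ ≤ _ := this
      _ = _ := by ring
  have hqP : ∀ x ∈ Metric.ball (0 : EuclideanSpace ℝ (Fin n)) (ϱ * r),
      dist (q 0 x) P ≤ L := by
    intro x hx
    have hs2 : Metric.closedBall x (σ 1) ⊆ Metric.ball 0 r :=
      (hsubc 0 x).trans (hsubb x hx _ (hσR 0).le)
    have hvol := Measure.addHaar_real_closedBall
      (volume : Measure (EuclideanSpace ℝ (Fin n))) x (hσpos 1).le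
    rw [finrank_euclideanSpace_fin, ← hw] at hvol
    have hPint : ∫ y in Metric.closedBall x (σ 1), dist (f y) P ^ 2 ≤ σ 1 ^ n * w := by
      have h1 : ∫ y in Metric.closedBall x (σ 1), dist (f y) P ^ 2 ≤
          ∫ _y in Metric.closedBall x (σ 1), (1 : ℝ) := by
        apply integral_mono_ae ((hint P).mono_set hs2)
        · exact integrableOn_const measure_closedBall_lt_top.ne
        · filter_upwards [ae_restrict_of_ae_restrict_of_subset hs2 hfP] with y hy
          have : (0:ℝ) ≤ dist (f y) P := dist_nonneg
          exact pow_le_one₀ this (by linarith)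
      rw [setIntegral_const, hvol, smul_eq_mul, mul_one] at h1
      exact h1
    have h1 := camp_tri f x (σ 1) (hσpos 1).le (fun Q => (hint Q).mono_set hs2) _ _ _ _
      (hqS 0 x hx _ (hsubc 0 x)) hPint
    rw [← hw] at h1
    have hpk : σ 0 = 2 * σ 1 := by linarith [hσsucc 0]
    have h4 : dist (q 0 x) P ^ 2 * (σ 1 ^ n * w) ≤
        (2 * (2 * K ^ 2 * a 0 ^ 2 * 2 ^ n + w)) * σ 1 ^ n := by
      have : σ 0 ^ n = 2 ^ n * σ 1 ^ n := by rw [hpk, mul_pow]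
      calc _ ≤ _ := h1
        _ = _ := by rw [this]; ring
    have h5 := camp_sq (pow_pos (hσpos 1) n) hwpos h4
    rw [← hL] at h5
    exact le_of_abs_le (abs_le_of_sq_le_sq h5 hL0)
  classical
  refine ⟨fun x => if x ∈ Metric.ball (0 : EuclideanSpace ℝ (Fin n)) (ϱ * r) then G x else f x,
    ?_, ?_⟩
  · have hσ0 : Filter.Tendsto σ Filter.atTop (nhds 0) := by
      have h := (tendsto_pow_atTop_nhds_zero_of_lt_one (r := (1 / 2 : ℝ)) (by norm_num)
        (by norm_num)).const_mul (R / 2)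
      rw [mul_zero] at h
      exact h.congr fun k => (hσ k).symm
    have ha0' : Filter.Tendsto a Filter.atTop (nhds 0) := by
      have h := (tendsto_pow_atTop_nhds_zero_of_lt_one hρ0.le hρ1).const_mul (a 0)
      rw [mul_zero] at h
      exact h.congr fun k => (hak k).symm
    have he0 : Filter.Tendsto (fun k => 2 * K ^ 2 * a k ^ 2 * 2 ^ n) Filter.atTop (nhds 0) := by
      have h := ((ha0'.pow 2).const_mul (2 * K ^ 2)).mul_const ((2:ℝ) ^ n)
      simpa using h
    have := camp_ae r f hf hint (Metric.ball 0 (ϱ * r))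
      (Metric.ball_subset_ball (by nlinarith)) (fun k => σ (k + 1))
      (fun k => 2 * K ^ 2 * a k ^ 2 * 2 ^ n) (fun k => hσpos _)
      ((Filter.tendsto_add_atTop_iff_nat 1).2 hσ0) he0 q G hG
      (fun x hx k => (hsubc k x).trans (hsubb x hx _ (hσR k).le))
      (fun x hx k => by
        refine (hqS k x hx _ (hsubc k x)).trans_eq ?_
        have hpk : σ k = 2 * σ (k + 1) := by linarith [hσsucc k]
        have : σ k ^ n = 2 ^ n * σ (k + 1) ^ n := by rw [hpk, mul_pow]
        rw [this]; ring)
    filter_upwards [this] with x hx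
    split_ifs with h
    · exact hx h
    · rfl
  · intro x hx y hy
    simp only [if_pos hx, if_pos hy]
    rcases eq_or_ne x y with rfl | hxy
    · simp only [dist_self]
      rw [Real.zero_rpow hβ0.ne', mul_zero]
    have hδ : 0 < dist x y := dist_pos.2 hxy
    have hδβ : 0 < dist x y ^ β := Real.rpow_pos_of_pos hδ _
    have hC1 : 0 ≤ 4 * M * (2 * T + 1) := by positivity
    have hC2 : 0 ≤ 2 * (M * a 0 * T + L) / a 1 := by positivity
    rcases le_or_gt (dist x y) (σ 1) with hle | hgt
    · obtain ⟨k, hk1, hk2⟩ := exists_nat_pow_near_of_lt_one (div_pos hδ (hσpos 1))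
        ((div_le_one (hσpos 1)).2 hle) (by norm_num : (0:ℝ) < 1 / 2) (by norm_num)
      rw [lt_div_iff₀ (hσpos 1)] at hk1
      rw [div_le_iff₀ (hσpos 1)] at hk2
      have e1 : (1 / 2 : ℝ) ^ k * σ 1 = σ (k + 1) := by rw [hσ, hσ]; ring
      have e2 : (1 / 2 : ℝ) ^ (k + 1) * σ 1 = σ k / 4 := by rw [hσ, hσ]; ring
      rw [e1] at hk2
      rw [e2] at hk1
      have hak4 : a k ≤ 4 * dist x y ^ β := by
        rw [ha]
        calc σ k ^ β ≤ (4 * dist x y) ^ β :=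
              Real.rpow_le_rpow (hσpos k).le (by linarith) hβ0.le
          _ = 4 ^ β * dist x y ^ β := Real.mul_rpow (by norm_num) hδ.le
          _ ≤ 4 * dist x y ^ β := by
              gcongr
              calc (4:ℝ) ^ β ≤ 4 ^ (1:ℝ) :=
                    Real.rpow_le_rpow_of_exponent_le (by norm_num) hβ1
                _ = 4 := Real.rpow_one 4
      have t1 := hGq x hx k
      have t2 := hstep k x hx y hy hk2
      have t3 := hGq y hy (k + 1)
      have t4 : M * a (k + 1) * T ≤ M * a k * T := by
        have := hasucc k
        gcongr
      have t5 := dist_triangle4 (G x) (q k x) (q (k + 1) y) (G y)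
      rw [dist_comm (G x) (q k x)] at t5
      have t6 : M * (2 * T + 1) * a k ≤ M * (2 * T + 1) * (4 * dist x y ^ β) := by
        gcongr
      have t8 := mul_nonneg hC2 hδβ.le
      rw [add_mul, add_mul]
      linarith
    · have hb : a 1 ≤ dist x y ^ β := by
        rw [ha]; exact Real.rpow_le_rpow (hσpos 1).le hgt.le hβ0.le
      have t1 := hGq x hx 0
      have t2 := hqP x hx
      have t3 := hGq y hy 0
      have t4 := hqP y hy
      have t5 := dist_triangle4 (G x) (q 0 x) (q 0 y) (G y)
      rw [dist_comm (G x) (q 0 x)] at t5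
      have t6 := dist_triangle_right (q 0 x) (q 0 y) P
      have t7 : 2 * (M * a 0 * T + L) / a 1 * a 1 ≤
          2 * (M * a 0 * T + L) / a 1 * dist x y ^ β := mul_le_mul_of_nonneg_left hb hC2
      rw [div_mul_cancel₀ _ ha1.ne'] at t7
      have t8 := mul_nonneg hC1 hδβ.le
      rw [add_mul, add_mul]
      linarith
end
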